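/- Let L, L_r, L_s, Σ, Q be a normed continuous-time Markov game structure, fix t ∈ ℝ and 0 < ε ≤ 1, and let x : L → ℝ satisfy x(l) ∈ [0,1] for all l. Let f : L → ℝ → ℝ solve the Bellman equations on [t−ε, t] with terminal value x and take values in [0,1] on [t−ε,t], and let p1 be a single ε-net approximation from x. Then ‖f(·, t−ε) − p1(·, t−ε)‖ ≤ ε², where ‖·‖ is the sup-norm over locations; more generally ‖f(·, t−τ) − p1(·, t−τ)‖ ≤ τ² for every τ ∈ [0,ε]. -/

import Mathlib

/-- A normed continuous-time Markov game structure: a finite nonempty set `L` of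
locations partitioned into reachability locations (`isReach l = true`) and safety
locations (`isReach l = false`), a finite set `A` of actions with a nonempty set
`enabled l` of enabled actions at each location, and a rate matrix `R` whose rows
(for enabled actions) are probability distributions on `L`. -/
structure NCTMG (L A : Type) [Fintype L] [DecidableEq L] [Fintype A] where
  isReach : L → Bool
  enabled : L → Finset A
  enabled_nonempty : ∀ l, (enabled l).Nonempty
  R : L → A → L → ℝ
  R_nonneg : ∀ l a l', a ∈ enabled l → 0 ≤ R l a l'
  R_sum : ∀ l a, a ∈ enabled l → (∑ l', R l a l') = 1

namespace NCTMG

variable {L A : Type} [Fintype L] [DecidableEq L] [Fintype A]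

/-- The generator `Q(l,a,l') = R(l,a,l') − δ_{l,l'}`. -/
def Q (M : NCTMG L A) (l : L) (a : A) (l' : L) : ℝ :=
  M.R l a l' - (if l = l' then 1 else 0)

/-- `opt_l`: maximum over enabled actions at reachability locations, minimum
over enabled actions at safety locations. -/
noncomputable def opt (M : NCTMG L A) (l : L) (v : A → ℝ) : ℝ :=
  if M.isReach l then (M.enabled l).sup' (M.enabled_nonempty l) v
  else (M.enabled l).inf' (M.enabled_nonempty l) v

/-- `f` solves the Bellman equations on `[t−ε, t]` with terminal value `x`. -/
def SolvesBellman (M : NCTMG L A) (t ε : ℝ) (x : L → ℝ) (f : L → ℝ → ℝ) : Prop :=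
  (∀ l, f l t = x l) ∧
  ∀ l, ∀ τ ∈ Set.Icc (t - ε) t,
    HasDerivAt (f l) (-(M.opt l (fun a => ∑ l', M.Q l a l' * f l' τ))) τ

/-- `p1` is a single `ε`-net approximation from terminal value `x` with chosen
actions `act`: each `act l` is enabled and attains `opt_l` of `∑ Q(l,a,·)·x`,
and `p1(l, t−τ) = x(l) + τ·c_l` on `[0,ε]` where `c_l = ∑ Q(l,act l,·)·x`. -/
def IsSingleNet (M : NCTMG L A) (t ε : ℝ) (x : L → ℝ) (act : L → A)
    (p1 : L → ℝ → ℝ) : Prop :=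
  (∀ l, act l ∈ M.enabled l) ∧
  (∀ l, (∑ l', M.Q l (act l) l' * x l') =
      M.opt l (fun a => ∑ l', M.Q l a l' * x l')) ∧
  (∀ l, ∀ τ ∈ Set.Icc (0 : ℝ) ε,
      p1 l (t - τ) = x l + τ * (∑ l', M.Q l (act l) l' * x l'))

end NCTMG

/-- The sup-norm `‖v‖ = max_{l∈L} |v l|` on functions `L → ℝ`. -/
noncomputable def supNorm {L : Type} [Fintype L] [Nonempty L] (v : L → ℝ) : ℝ :=
  Finset.univ.sup' Finset.univ_nonempty (fun l => |v l|)


namespace NCTMG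

variable {L A : Type} [Fintype L] [DecidableEq L] [Fintype A]

/-- `opt` is monotone up to an additive constant. -/
theorem opt_le_opt_add (M : NCTMG L A) (l : L) {v w : A → ℝ} {c : ℝ}
    (h : ∀ a ∈ M.enabled l, v a ≤ w a + c) : M.opt l v ≤ M.opt l w + c := by
  unfold opt
  split_ifs
  · refine Finset.sup'_le _ _ fun a ha => (h a ha).trans ?_
    gcongr
    exact Finset.le_sup' w ha
  · obtain ⟨a, ha, hw⟩ := Finset.exists_mem_eq_inf' (M.enabled_nonempty l) w
    rw [hw]
    exact (Finset.inf'_le v ha).trans (h a ha)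

/-- `opt` is nonexpansive for the sup-norm over enabled actions. -/
theorem abs_opt_sub_opt_le (M : NCTMG L A) (l : L) {v w : A → ℝ} {c : ℝ}
    (h : ∀ a ∈ M.enabled l, |v a - w a| ≤ c) : |M.opt l v - M.opt l w| ≤ c := by
  have h₁ := M.opt_le_opt_add l (v := v) (w := w) (c := c)
    fun a ha => by linarith [(abs_le.1 (h a ha)).2]
  have h₂ := M.opt_le_opt_add l (v := w) (w := v) (c := c)
    fun a ha => by linarith [(abs_le.1 (h a ha)).1]
  exact abs_le.2 ⟨by linarith, by linarith⟩

theorem opt_zero (M : NCTMG L A) (l : L) : M.opt l (fun _ => 0) = 0 := by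
  simp [opt]

theorem abs_opt_le (M : NCTMG L A) (l : L) {v : A → ℝ} {c : ℝ}
    (h : ∀ a ∈ M.enabled l, |v a| ≤ c) : |M.opt l v| ≤ c := by
  simpa [opt_zero] using M.abs_opt_sub_opt_le l (v := v) (w := fun _ => 0) (c := c)
    (by simpa using h)

theorem sum_Q_mul (M : NCTMG L A) (l : L) (a : A) (y : L → ℝ) :
    ∑ l', M.Q l a l' * y l' = (∑ l', M.R l a l' * y l') - y l := by
  simp [Q, sub_mul, Finset.sum_sub_distrib]

/-- A row average of `R` stays in any interval containing the values averaged. -/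
theorem sum_R_mul_mem_Icc (M : NCTMG L A) {l : L} {a : A} (ha : a ∈ M.enabled l)
    {y : L → ℝ} {b c : ℝ} (hy : ∀ l', y l' ∈ Set.Icc b c) :
    ∑ l', M.R l a l' * y l' ∈ Set.Icc b c :=
  (convex_Icc b c).sum_mem (fun l' _ => M.R_nonneg l a l' ha) (M.R_sum l a ha)
    fun l' _ => hy l'

theorem abs_sum_Q_mul_le (M : NCTMG L A) {l : L} {a : A} (ha : a ∈ M.enabled l)
    {y : L → ℝ} {b c : ℝ} (hy : ∀ l', y l' ∈ Set.Icc b c) :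
    |∑ l', M.Q l a l' * y l'| ≤ c - b := by
  rw [sum_Q_mul]
  have h := M.sum_R_mul_mem_Icc ha hy
  exact abs_le.2 ⟨by linarith [h.1, (hy l).2], by linarith [h.2, (hy l).1]⟩

/-- The Bellman equations in reversed time `s ↦ t - s`. -/
theorem SolvesBellman.hasDerivAt_sub {M : NCTMG L A} {t ε : ℝ} {x : L → ℝ}
    {f : L → ℝ → ℝ} (hf : M.SolvesBellman t ε x f) (l : L) {s : ℝ}
    (hs : s ∈ Set.Icc 0 ε) :
    HasDerivAt (fun s => f l (t - s))
      (M.opt l (fun a => ∑ l', M.Q l a l' * f l' (t - s))) s := by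
  simpa using (hf.2 l (t - s) ⟨by linarith [hs.2], by linarith [hs.1]⟩).comp_const_sub t s

end NCTMG

/-- A function vanishing at `0` is bounded by `B` if its derivative is bounded by that of `B`. -/
theorem abs_le_of_abs_hasDerivAt_le {g g' B B' : ℝ → ℝ} {ε : ℝ}
    (hg : ∀ s ∈ Set.Icc 0 ε, HasDerivAt g (g' s) s) (hg0 : g 0 = 0)
    (hB : ∀ s, HasDerivAt B (B' s) s) (hB0 : 0 ≤ B 0)
    (bound : ∀ s ∈ Set.Icc 0 ε, |g' s| ≤ B' s) {s : ℝ} (hs : s ∈ Set.Icc 0 ε) :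
    |g s| ≤ B s :=
  image_norm_le_of_norm_deriv_right_le_deriv_boundary
    (fun s hs => (hg s hs).continuousAt.continuousWithinAt)
    (fun s hs => (hg s (Set.Ico_subset_Icc_self hs)).hasDerivWithinAt)
    (by simpa [hg0] using hB0) hB
    (fun s hs => bound s (Set.Ico_subset_Icc_self hs)) hs

/-- the single ε-net approximation has step error at most `ε²`;
more generally the error after `τ ≤ ε` time units is at most `τ²`. -/
theorem single_net_step_error {L A : Type} [Fintype L] [DecidableEq L]
    [Nonempty L] [Fintype A] (M : NCTMG L A) (t ε : ℝ) (hε0 : 0 < ε)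
    (hε1 : ε ≤ 1)
    (x : L → ℝ) (hx : ∀ l, x l ∈ Set.Icc (0 : ℝ) 1)
    (f : L → ℝ → ℝ) (hf : M.SolvesBellman t ε x f)
    (hf01 : ∀ l, ∀ τ ∈ Set.Icc (t - ε) t, f l τ ∈ Set.Icc (0 : ℝ) 1)
    (act : L → A) (p1 : L → ℝ → ℝ) (hp1 : M.IsSingleNet t ε x act p1) :
    supNorm (fun l => f l (t - ε) - p1 l (t - ε)) ≤ ε ^ 2 ∧
    ∀ τ ∈ Set.Icc (0 : ℝ) ε,
      supNorm (fun l => f l (t - τ) - p1 l (t - τ)) ≤ τ ^ 2 := by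
  suffices h : ∀ τ ∈ Set.Icc (0 : ℝ) ε,
      supNorm (fun l => f l (t - τ) - p1 l (t - τ)) ≤ τ ^ 2 from
    ⟨h ε ⟨hε0.le, le_rfl⟩, h⟩
  obtain ⟨-, hact, hp⟩ := hp1
  have near : ∀ l, ∀ s ∈ Set.Icc (0 : ℝ) ε, |f l (t - s) - x l| ≤ s := by
    intro l s hs
    refine abs_le_of_abs_hasDerivAt_le (B := id) (g := fun s => f l (t - s) - x l)
      (fun s hs => (hf.hasDerivAt_sub l hs).sub_const (x l)) (by simp [hf.1 l])
      (fun s => hasDerivAt_id s) le_rfl (fun s hs => ?_) hs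
    refine M.abs_opt_le l fun a ha => ?_
    simpa using M.abs_sum_Q_mul_le ha
      fun l' => hf01 l' (t - s) ⟨by linarith [hs.2], by linarith [hs.1]⟩
  intro τ hτ
  refine Finset.sup'_le _ _ fun l _ => ?_
  beta_reduce
  rw [hp l τ hτ, ← sub_sub]
  refine abs_le_of_abs_hasDerivAt_le (B := fun s => s ^ 2) (B' := fun s => 2 * s)
    (g := fun s => f l (t - s) - x l - s * ∑ l', M.Q l (act l) l' * x l')
    (fun s hs => ((hf.hasDerivAt_sub l hs).sub_const (x l)).sub
      ((hasDerivAt_id s).mul_const _)) (by simp [hf.1 l])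
    (fun s => by simpa using hasDerivAt_pow 2 s) (by simp) (fun s hs => ?_) hτ
  rw [one_mul, hact l]
  refine M.abs_opt_sub_opt_le l fun a ha => ?_
  have h := M.abs_sum_Q_mul_le ha (y := fun l' => f l' (t - s) - x l')
    fun l' => abs_le.1 (near l' s hs)
  simp only [mul_sub, Finset.sum_sub_distrib] at h
  linarith
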